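/- arXiv:math/0610343 — 2 statements merged into one kernel-verified Lean document; each statement's English description precedes it below -/
import Mathlib

section
/- For any two bubbles A and B of the basilica polynomial f, exactly one of the following holds: (1) the closures of A and B are disjoint; (2) the closures of A and B intersect in exactly one point x, and this point is an iterated preimage of the dividing fixed point, i.e. f^n(x) = α for some n ≥ 0; (3) A = B. -/
open Filter Topology

/-- The basilica polynomial `f(z) = z² − 1`. -/
noncomputable def fBasilica : ℂ → ℂ := fun z => z ^ 2 - 1

/-- The basin of attraction of the superattracting 2-cycle `0 ↦ −1 ↦ 0`. -/
def basilicaBasin : Set ℂ :=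
  {z | Tendsto (fun n => fBasilica^[2 * n] z) atTop (𝓝 0) ∨
       Tendsto (fun n => fBasilica^[2 * n] z) atTop (𝓝 (-1))}

/-- A bubble is a connected component of the basin. -/
def IsBubble (F : Set ℂ) : Prop :=
  ∃ z ∈ basilicaBasin, F = connectedComponentIn basilicaBasin z

/-- The dividing (α) fixed point of the basilica, `α = (1 − √5)/2`. -/
noncomputable def alphaFix : ℂ := ((1 - Real.sqrt 5 : ℝ) : ℂ) / 2

namespace Basilica


lemma f_apply (z : ℂ) : fBasilica z = z ^ 2 - 1 := rfl

lemma f_cont : Continuous fBasilica := by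
  have : fBasilica = fun z : ℂ => z ^ 2 - 1 := rfl
  rw [this]; fun_prop

lemma f_neg (z : ℂ) : fBasilica (-z) = fBasilica z := by simp [f_apply]

lemma f_zero : fBasilica 0 = -1 := by simp [f_apply]
lemma f_neg_one : fBasilica (-1) = 0 := by simp [f_apply]

lemma f_eq {z w : ℂ} (h : fBasilica z = fBasilica w) : z = w ∨ z = -w := by
  simp only [f_apply] at h
  exact sq_eq_sq_iff_eq_or_eq_neg.mp (by linear_combination h)

lemma f_re (z : ℂ) : (fBasilica z).re = z.re ^ 2 - z.im ^ 2 - 1 := by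
  simp [f_apply, pow_two]

lemma f_im (z : ℂ) : (fBasilica z).im = 2 * z.re * z.im := by
  simp [f_apply, pow_two]; ring

lemma f_analytic : AnalyticOnNhd ℂ fBasilica Set.univ := by
  have : Differentiable ℂ fBasilica := by
    have : fBasilica = fun z : ℂ => z ^ 2 - 1 := rfl
    rw [this]; fun_prop
  exact this.differentiableOn.analyticOnNhd isOpen_univ

lemma f_open : IsOpenMap fBasilica := by
  intro s hs
  rcases f_analytic.is_constant_or_isOpen isPreconnected_univ with ⟨w, hw⟩ | h
  · have h1 := hw 0 trivial
    have h2 := hw (-1) trivial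
    rw [f_zero] at h1
    rw [f_neg_one] at h2
    rw [← h2] at h1
    norm_num at h1
  · exact h s (Set.subset_univ _) hs

/-- `a = -α`, positive. -/
noncomputable def a : ℝ := (Real.sqrt 5 - 1) / 2

lemma alpha_eq : alphaFix = ((-a : ℝ) : ℂ) := by
  simp only [alphaFix, a]; push_cast; ring

lemma a_sq : a ^ 2 = 1 - a := by
  have := Real.sq_sqrt (show (0 : ℝ) ≤ 5 by norm_num)
  simp only [a]; nlinarith

lemma a_gt : 0.618 < a := by
  have : (2.236 : ℝ) < Real.sqrt 5 := Real.lt_sqrt_of_sq_lt (by norm_num)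
  simp only [a]; linarith

lemma a_lt : a < 0.6181 := by
  have : Real.sqrt 5 < 2.2362 := by
    rw [Real.sqrt_lt' (by norm_num)]; norm_num
  simp only [a]; linarith

lemma alpha_re : alphaFix.re = -a := by rw [alpha_eq]; exact Complex.ofReal_re _
lemma alpha_im : alphaFix.im = 0 := by rw [alpha_eq]; exact Complex.ofReal_im _

lemma f_alpha : fBasilica alphaFix = alphaFix := by
  apply Complex.ext
  · rw [f_re, alpha_re, alpha_im]; have := a_sq; nlinarith
  · rw [f_im, alpha_im]; ring

/-! ### Escaping set -/

def Esc : Set ℂ := {z | ∃ n, 2 < ‖fBasilica^[n] z‖}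

lemma Esc_open : IsOpen Esc := by
  have : Esc = ⋃ n, {z | 2 < ‖fBasilica^[n] z‖} := by ext; simp [Esc]
  rw [this]
  exact isOpen_iUnion fun n => isOpen_lt continuous_const (f_cont.iterate n).norm

lemma norm_f_ge (z : ℂ) : ‖z‖ ^ 2 - 1 ≤ ‖fBasilica z‖ := by
  have := norm_sub_norm_le (z ^ 2) 1
  simpa [f_apply] using this

lemma Esc_of_f {z : ℂ} (h : fBasilica z ∈ Esc) : z ∈ Esc := by
  obtain ⟨n, hn⟩ := h
  exact ⟨n + 1, by simpa using hn⟩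

lemma Esc_of_iter {z : ℂ} (n : ℕ) (h : fBasilica^[n] z ∈ Esc) : z ∈ Esc := by
  induction n with
  | zero => simpa using h
  | succ n ih => exact ih (Esc_of_f (by rwa [Function.iterate_succ_apply'] at h))

lemma Esc_of_big {z : ℂ} (h : 1.7 ≤ ‖z‖) : z ∈ Esc := by
  have h1 := norm_f_ge z
  have h2 := norm_f_ge (fBasilica z)
  have h3 : 1.89 ≤ ‖fBasilica z‖ := by nlinarith
  exact ⟨2, by show 2 < ‖fBasilica (fBasilica z)‖; nlinarith⟩

lemma Esc_stay {z : ℂ} (h : 2 < ‖z‖) (n : ℕ) : 2 < ‖fBasilica^[n] z‖ := by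
  induction n with
  | zero => simpa using h
  | succ n ih =>
    rw [Function.iterate_succ_apply']
    have := norm_f_ge (fBasilica^[n] z)
    nlinarith

lemma Esc_disj {z : ℂ} (h : z ∈ Esc) : z ∉ basilicaBasin := by
  obtain ⟨n, hn⟩ := h
  have key : ∀ m, n ≤ 2 * m → 2 < ‖fBasilica^[2 * m] z‖ := by
    intro m hm
    obtain ⟨k, hk⟩ := Nat.exists_eq_add_of_le hm
    rw [hk, add_comm, Function.iterate_add_apply]
    exact Esc_stay hn k
  have ev : ∀ᶠ m in atTop, 2 ≤ ‖fBasilica^[2 * m] z‖ := by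
    filter_upwards [eventually_ge_atTop n] with m hm
    exact (key m (by omega)).le
  rintro (h | h)
  · have := ge_of_tendsto h.norm ev
    norm_num at this
  · have := ge_of_tendsto h.norm ev
    norm_num at this

lemma Esc_disj_closure {z : ℂ} (h : z ∈ Esc) : z ∉ closure basilicaBasin := by
  intro hc
  obtain ⟨w, hw, hw'⟩ := mem_closure_iff.mp hc Esc Esc_open h
  exact Esc_disj hw hw'

lemma stage2 {z : ℂ} (h2 : 0.44 ≤ z.im ^ 2) (h1 : z.re ≤ -a) : z ∈ Esc := by
  apply Esc_of_iter 2
  apply Esc_of_big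
  show 1.7 ≤ ‖fBasilica (fBasilica z)‖
  have hx : 0.38 ≤ z.re ^ 2 := by have := a_gt; nlinarith
  have e : ‖fBasilica (fBasilica z)‖ ^ 2 = (z.re ^ 2 + z.im ^ 2) ^ 2 *
      ((z.re ^ 2 + z.im ^ 2 - 2) ^ 2 + 8 * z.im ^ 2) := by
    rw [Complex.sq_norm, Complex.normSq_apply, f_re (fBasilica z), f_im (fBasilica z), f_re, f_im]
    ring
  generalize hN : z.re ^ 2 + z.im ^ 2 = N at e
  have hN' : 0.82 ≤ N := by linarith
  have : (1.7 : ℝ) ^ 2 ≤ ‖fBasilica (fBasilica z)‖ ^ 2 := by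
    rw [e]
    rcases le_total N 0.92 with h | h
    · have i1 : (0.82 : ℝ) ^ 2 ≤ N ^ 2 := by gcongr
      have i2 : 4.6 ≤ (N - 2) ^ 2 + 8 * z.im ^ 2 := by nlinarith
      nlinarith
    · have i1 : (0.92 : ℝ) ^ 2 ≤ N ^ 2 := by gcongr
      have i2 : 3.52 ≤ (N - 2) ^ 2 + 8 * z.im ^ 2 := by nlinarith
      nlinarith
  exact le_of_sq_le_sq this (norm_nonneg _)

lemma stage1 {z : ℂ} (h1 : z.re ≤ -a) (h2 : 0 ≤ 4 * a ^ 2 * (z.re + a) + z.im ^ 2)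
    (h3 : z.im ^ 2 ≤ 0.44) :
    (fBasilica z).re ≤ -a ∧ 0 ≤ 4 * a ^ 2 * ((fBasilica z).re + a) + (fBasilica z).im ^ 2 ∧
      1.5 * z.im ^ 2 ≤ (fBasilica z).im ^ 2 := by
  have ha := a_sq
  have g := a_gt
  have l := a_lt
  have hp : a ^ 2 ≤ z.re ^ 2 := by nlinarith
  rw [f_re, f_im]
  have hq := sq_nonneg z.im
  refine ⟨?_, ?_, ?_⟩
  · generalize z.im ^ 2 = Y at *
    obtain ⟨s, hs⟩ : ∃ s, s = -(z.re + a) := ⟨_, rfl⟩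
    have hr : z.re = -a - s := by linarith
    have hs0 : 0 ≤ s := by linarith
    have hs1 : 4 * a ^ 2 * s ≤ Y := by rw [hs]; linarith
    have ha2 : 0.3819 ≤ a ^ 2 := by linarith
    have hs2 : 1.5276 * s ≤ Y := by nlinarith
    rw [hr]
    have : s * s ≤ s * 0.28804 := by
      apply mul_le_mul_of_nonneg_left _ hs0; linarith
    nlinarith
  · have : 0 ≤ 4 * (a ^ 2 + z.im ^ 2) * (z.re ^ 2 - a ^ 2) := by
      apply mul_nonneg (by positivity); linarith
    have e : z.re ^ 2 - z.im ^ 2 - 1 + a = z.re ^ 2 - a ^ 2 - z.im ^ 2 := by linarith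
    rw [e]; linarith
  · have : 1.5 ≤ 4 * z.re ^ 2 := by linarith
    nlinarith

lemma line_esc {z : ℂ} (h1 : z.re = -a) (h2 : z.im ≠ 0) : z ∈ Esc := by
  by_contra hE
  have hE' : ∀ n, fBasilica^[n] z ∉ Esc := fun n h => hE (Esc_of_iter n h)
  have key : ∀ n, (fBasilica^[n] z).re ≤ -a ∧ 0 ≤ 4 * a ^ 2 * ((fBasilica^[n] z).re + a) + (fBasilica^[n] z).im ^ 2 ∧
      1.5 ^ n * z.im ^ 2 ≤ (fBasilica^[n] z).im ^ 2 := by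
    intro n
    induction n with
    | zero =>
      refine ⟨h1.le, ?_, ?_⟩
      · simp [h1, sq_nonneg]
      · simp
    | succ n ih =>
      obtain ⟨i1, i2, i3⟩ := ih
      have h3 : (fBasilica^[n] z).im ^ 2 ≤ 0.44 := by
        by_contra hc
        exact hE' n (stage2 (not_le.mp hc).le i1)
      obtain ⟨j1, j2, j3⟩ := stage1 i1 i2 h3
      rw [Function.iterate_succ_apply']
      refine ⟨j1, j2, ?_⟩
      rw [pow_succ]; linarith
  have hpos : 0 < z.im ^ 2 := by positivity
  obtain ⟨n, hn⟩ := pow_unbounded_of_one_lt (0.44 / z.im ^ 2) (show (1 : ℝ) < 1.5 by norm_num)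
  rw [div_lt_iff₀ hpos] at hn
  obtain ⟨i1, i2, i3⟩ := key n
  exact hE' n (stage2 (by linarith) i1)

/-! ### The basin -/

lemma basin_of_contract (S : Set ℂ) (c : ℝ) (hc0 : 0 ≤ c) (hc : c < 1)
    (hS : ∀ z ∈ S, fBasilica (fBasilica z) ∈ S ∧ ‖fBasilica (fBasilica z)‖ ≤ c * ‖z‖) {z : ℂ} (hz : z ∈ S) : z ∈ basilicaBasin := by
  left
  have key : ∀ n, fBasilica^[2 * n] z ∈ S ∧ ‖fBasilica^[2 * n] z‖ ≤ c ^ n * ‖z‖ := by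
    intro n
    induction n with
    | zero => simpa using hz
    | succ n ih =>
      have e : fBasilica^[2 * (n + 1)] z = fBasilica (fBasilica (fBasilica^[2 * n] z)) := by
        rw [show 2 * (n + 1) = 2 * n + 1 + 1 by ring, Function.iterate_succ_apply',
          Function.iterate_succ_apply']
      rw [e]
      obtain ⟨h1, h2⟩ := hS _ ih.1
      refine ⟨h1, h2.trans ?_⟩
      rw [pow_succ]
      nlinarith [ih.2]
  apply squeeze_zero_norm (fun n => (key n).2)
  simpa using (tendsto_pow_atTop_nhds_zero_of_lt_one hc0 hc).mul_const ‖z‖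

lemma ff (z : ℂ) : fBasilica (fBasilica z) = z * (z * (z ^ 2 - 2)) := by simp only [f_apply]; ring

lemma ball_basin {z : ℂ} (hz : z ∈ Metric.ball (0 : ℂ) (1 / 4)) : z ∈ basilicaBasin := by
  apply basin_of_contract (Metric.ball (0 : ℂ) (1 / 4)) 0.9 (by norm_num) (by norm_num) _ hz
  intro w hw
  rw [mem_ball_zero_iff] at hw
  have h1 : ‖w ^ 2 - 2‖ ≤ ‖w‖ ^ 2 + 2 := by
    have := norm_sub_le (w ^ 2) 2
    simpa using this
  have h0 := norm_nonneg w
  have h2 : ‖fBasilica (fBasilica w)‖ ≤ 0.9 * ‖w‖ := by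
    rw [ff, norm_mul, norm_mul, mul_comm]
    apply mul_le_mul_of_nonneg_right _ h0
    have : ‖w ^ 2 - 2‖ ≤ 3 := by nlinarith
    nlinarith [norm_nonneg (w ^ 2 - 2)]
  refine ⟨?_, h2⟩
  rw [mem_ball_zero_iff]; linarith

lemma real_basin {x : ℝ} (hx : |x| < a) : (x : ℂ) ∈ basilicaBasin := by
  have ha := a_sq
  have g := a_gt
  have l := a_lt
  set r := |x| with hr
  have hr0 : 0 ≤ r := abs_nonneg x
  have hc : r * (2 - r ^ 2) < 1 := by
    have h1 : 0 < 1 - r - r ^ 2 := by nlinarith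
    nlinarith
  apply basin_of_contract ((fun y : ℝ => (y : ℂ)) '' {y | |y| ≤ r}) (r * (2 - r ^ 2))
    (by apply mul_nonneg hr0; nlinarith) hc _ ⟨x, le_refl r, rfl⟩
  rintro _ ⟨y, hy, rfl⟩
  simp only [Set.mem_ofPred_eq] at hy
  have h0 := abs_nonneg y
  have e : fBasilica (fBasilica (y : ℂ)) = ((y * (y * (y ^ 2 - 2)) : ℝ) : ℂ) := by rw [ff]; push_cast; ring
  have b : |y * (y * (y ^ 2 - 2))| ≤ r * (2 - r ^ 2) * |y| := by
    rw [abs_mul, abs_mul, mul_comm]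
    apply mul_le_mul_of_nonneg_right _ h0
    have : |y ^ 2 - 2| = 2 - |y| ^ 2 := by
      rw [sq_abs, abs_of_nonpos] <;> nlinarith [sq_abs y]
    rw [this]
    generalize |y| = t at *
    have : 0 ≤ (r - t) * (2 - (r ^ 2 + r * t + t ^ 2)) := by
      apply mul_nonneg (by linarith); nlinarith
    nlinarith
  refine ⟨⟨_, ?_, e.symm⟩, ?_⟩
  · simp only [Set.mem_ofPred_eq]
    nlinarith
  · dsimp only
    rw [e, Complex.norm_real, Complex.norm_real]; exact b

lemma iter_f (n : ℕ) (z : ℂ) : fBasilica^[n] (fBasilica z) = fBasilica (fBasilica^[n] z) :=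
  (Function.iterate_succ_apply fBasilica n z).symm.trans (Function.iterate_succ_apply' fBasilica n z)

lemma basin_f {z : ℂ} (h : z ∈ basilicaBasin) : fBasilica z ∈ basilicaBasin := by
  rcases h with h | h
  · right
    have := (f_cont.tendsto 0).comp h
    rw [f_zero] at this
    exact this.congr fun n => (iter_f _ _).symm
  · left
    have := (f_cont.tendsto (-1)).comp h
    rw [f_neg_one] at this
    exact this.congr fun n => (iter_f _ _).symm

lemma basin_of_f {z : ℂ} (h : fBasilica z ∈ basilicaBasin) : z ∈ basilicaBasin := by
  have e : ∀ n, fBasilica (fBasilica^[2 * n] (fBasilica z)) = fBasilica^[2 * (n + 1)] z := by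
    intro n
    rw [show 2 * (n + 1) = 2 * n + 1 + 1 by ring, Function.iterate_succ_apply',
          Function.iterate_succ_apply', iter_f]
  rcases h with h | h
  · right
    have := (f_cont.tendsto 0).comp h
    rw [f_zero] at this
    rw [← tendsto_add_atTop_iff_nat 1]
    exact this.congr e
  · left
    have := (f_cont.tendsto (-1)).comp h
    rw [f_neg_one] at this
    rw [← tendsto_add_atTop_iff_nat 1]
    exact this.congr e

lemma basin_iff (z : ℂ) : fBasilica z ∈ basilicaBasin ↔ z ∈ basilicaBasin := ⟨basin_of_f, basin_f⟩

lemma basin_iter (n : ℕ) (z : ℂ) : fBasilica^[n] z ∈ basilicaBasin ↔ z ∈ basilicaBasin := by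
  induction n with
  | zero => simp
  | succ n ih => rw [Function.iterate_succ_apply', basin_iff, ih]

lemma basin_neg {z : ℂ} : -z ∈ basilicaBasin ↔ z ∈ basilicaBasin := by
  rw [← basin_iff (-z), f_neg, basin_iff]

lemma zero_basin : (0 : ℂ) ∈ basilicaBasin := ball_basin (by simp)
lemma neg_one_basin : (-1 : ℂ) ∈ basilicaBasin := by rw [← basin_iff, f_neg_one]; exact zero_basin

/-- each basin point eventually enters the small ball. -/
lemma basin_enter {z : ℂ} (h : z ∈ basilicaBasin) : ∃ n, fBasilica^[n] z ∈ Metric.ball (0 : ℂ) (1 / 4) := by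
  have hb : Metric.ball (0 : ℂ) (1 / 4) ∈ 𝓝 (0 : ℂ) := Metric.ball_mem_nhds _ (by norm_num)
  rcases h with h | h
  · obtain ⟨n, hn⟩ := (h.eventually hb).exists
    exact ⟨_, hn⟩
  · have := (f_cont.tendsto (-1)).comp h
    rw [f_neg_one] at this
    obtain ⟨n, hn⟩ := (this.eventually hb).exists
    exact ⟨2 * n + 1, by rw [Function.iterate_succ_apply']; exact hn⟩

lemma basin_open : IsOpen basilicaBasin := by
  have : basilicaBasin = ⋃ n, fBasilica^[n] ⁻¹' Metric.ball (0 : ℂ) (1 / 4) := by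
    ext z
    simp only [Set.mem_iUnion, Set.mem_preimage]
    exact ⟨basin_enter, fun ⟨n, hn⟩ => (basin_iter n z).mp (ball_basin hn)⟩
  rw [this]
  exact isOpen_iUnion fun n => Metric.isOpen_ball.preimage (f_cont.iterate n)

lemma iter_alpha (n : ℕ) : fBasilica^[n] alphaFix = alphaFix := Function.iterate_fixed f_alpha n

lemma alpha_not : alphaFix ∉ basilicaBasin := by
  intro h
  obtain ⟨n, hn⟩ := basin_enter h
  rw [iter_alpha, mem_ball_zero_iff] at hn
  have := Complex.abs_re_le_norm alphaFix
  rw [alpha_re, abs_neg] at this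
  have := le_abs_self a
  have := a_gt
  linarith

lemma re_ne {z : ℂ} (h : z ∈ basilicaBasin) : z.re ≠ -a := by
  intro hz
  by_cases hi : z.im = 0
  · have : z = alphaFix := Complex.ext (by rw [hz, alpha_re]) (by rw [hi, alpha_im])
    exact alpha_not (this ▸ h)
  · exact Esc_disj (line_esc hz hi) h

lemma closure_line {z : ℂ} (h : z ∈ closure basilicaBasin) (hz : z.re = -a) : z = alphaFix := by
  by_cases hi : z.im = 0
  · exact Complex.ext (by rw [hz, alpha_re]) (by rw [hi, alpha_im])
  · exact absurd h (Esc_disj_closure (line_esc hz hi))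

/-! ### Bubbles -/

lemma _root_.IsBubble.sub {D : Set ℂ} (h : IsBubble D) : D ⊆ basilicaBasin := by
  obtain ⟨z, hz, rfl⟩ := h; exact connectedComponentIn_subset _ _

lemma _root_.IsBubble.conn {D : Set ℂ} (h : IsBubble D) : IsPreconnected D := by
  obtain ⟨z, hz, rfl⟩ := h; exact isPreconnected_connectedComponentIn

lemma _root_.IsBubble.isOpen {D : Set ℂ} (h : IsBubble D) : IsOpen D := by
  obtain ⟨z, hz, rfl⟩ := h; exact basin_open.connectedComponentIn

lemma _root_.IsBubble.ne {D : Set ℂ} (h : IsBubble D) : D.Nonempty := by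
  obtain ⟨z, hz, rfl⟩ := h; exact ⟨z, mem_connectedComponentIn hz⟩

lemma _root_.IsBubble.eq_comp {D : Set ℂ} (h : IsBubble D) {z : ℂ} (hz : z ∈ D) :
    D = connectedComponentIn basilicaBasin z := by
  obtain ⟨w, hw, rfl⟩ := h; exact connectedComponentIn_eq hz

lemma _root_.IsBubble.eq {D E : Set ℂ} (h : IsBubble D) (h' : IsBubble E) {z : ℂ} (hz : z ∈ D)
    (hz' : z ∈ E) : D = E := (h.eq_comp hz).trans (h'.eq_comp hz').symm

lemma _root_.IsBubble.subset {D S : Set ℂ} (h : IsBubble D) (hS : IsPreconnected S) (hS' : S ⊆ basilicaBasin)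
    {z : ℂ} (hz : z ∈ D) (hz' : z ∈ S) : S ⊆ D := by
  rw [h.eq_comp hz]; exact hS.subset_connectedComponentIn hz' hS'

lemma _root_.IsBubble.closure_sub {D : Set ℂ} (h : IsBubble D) {z : ℂ} (hz : z ∈ closure D)
    (hz' : z ∈ basilicaBasin) : z ∈ D := by
  have hE : IsBubble (connectedComponentIn basilicaBasin z) := ⟨z, hz', rfl⟩
  obtain ⟨w, hw, hw'⟩ := mem_closure_iff.mp hz _ hE.isOpen (mem_connectedComponentIn hz')
  rw [h.eq hE hw' hw]; exact mem_connectedComponentIn hz'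

def B0 : Set ℂ := connectedComponentIn basilicaBasin 0
def B1 : Set ℂ := connectedComponentIn basilicaBasin (-1)

lemma hB0 : IsBubble B0 := ⟨0, zero_basin, rfl⟩
lemma hB1 : IsBubble B1 := ⟨-1, neg_one_basin, rfl⟩
lemma zero_mem : (0 : ℂ) ∈ B0 := mem_connectedComponentIn zero_basin
lemma neg_one_mem : (-1 : ℂ) ∈ B1 := mem_connectedComponentIn neg_one_basin

lemma _root_.IsBubble.neg {D : Set ℂ} (h : IsBubble D) : IsBubble (Neg.neg ⁻¹' D) := by
  obtain ⟨z, hz⟩ := h.ne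
  have hz' : -z ∈ basilicaBasin := basin_neg.mpr (h.sub hz)
  refine ⟨-z, hz', ?_⟩
  have hE : IsBubble (connectedComponentIn basilicaBasin (-z)) := ⟨-z, hz', rfl⟩
  have himg : ∀ S : Set ℂ, Neg.neg ⁻¹' S = Neg.neg '' S := by
    intro S; simp
  apply subset_antisymm
  · apply hE.subset _ _ (mem_connectedComponentIn hz') (by simpa using hz)
    · rw [himg]; exact h.conn.image _ continuous_neg.continuousOn
    · intro w hw; exact basin_neg.mp (h.sub hw)
  · intro w hw
    have : Neg.neg ⁻¹' (connectedComponentIn basilicaBasin (-z)) ⊆ D := by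
      apply h.subset _ _ hz (by simpa using mem_connectedComponentIn hz')
      · rw [himg]; exact hE.conn.image _ continuous_neg.continuousOn
      · intro w hw; exact basin_neg.mp (hE.sub hw)
    exact this (by simpa using hw)

lemma neg_B0 : Neg.neg ⁻¹' B0 = B0 :=
  hB0.neg.eq hB0 (z := 0) (by simpa using zero_mem) zero_mem

lemma closure_neg' {D : Set ℂ} {z : ℂ} : z ∈ closure (Neg.neg ⁻¹' D) ↔ -z ∈ closure D := by
  have := (Homeomorph.neg ℂ).preimage_closure D
  have h2 : Neg.neg ⁻¹' closure D = closure (Neg.neg ⁻¹' D) := this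
  rw [← h2]; rfl

lemma closure_f {D : Set ℂ} {z : ℂ} (h : z ∈ closure D) : fBasilica z ∈ closure (fBasilica '' D) :=
  image_closure_subset_closure_image f_cont ⟨z, h, rfl⟩

lemma _root_.IsBubble.image {D : Set ℂ} (h : IsBubble D) : IsBubble (fBasilica '' D) := by
  obtain ⟨z, hz⟩ := h.ne
  have hz' : fBasilica z ∈ basilicaBasin := basin_f (h.sub hz)
  refine ⟨fBasilica z, hz', ?_⟩
  have hE : IsBubble (connectedComponentIn basilicaBasin (fBasilica z)) := ⟨fBasilica z, hz', rfl⟩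
  have hsub : fBasilica '' D ⊆ connectedComponentIn basilicaBasin (fBasilica z) := by
    apply hE.subset _ _ (mem_connectedComponentIn hz') (Set.mem_image_of_mem fBasilica hz)
    · exact h.conn.image _ f_cont.continuousOn
    · rintro _ ⟨w, hw, rfl⟩; exact basin_f (h.sub hw)
  apply subset_antisymm hsub
  -- relatively clopen
  apply hE.conn.subset_of_closure_inter_subset (f_open _ h.isOpen)
    ⟨fBasilica z, mem_connectedComponentIn hz', ⟨z, hz, rfl⟩⟩
  rintro w ⟨hw, hw'⟩
  have hwB : w ∈ basilicaBasin := hE.sub hw'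
  rw [mem_closure_iff_seq_limit] at hw
  obtain ⟨u, hu, hlim⟩ := hw
  choose v hv hvu using hu
  have hbd : ∀ n, v n ∈ Metric.closedBall (0 : ℂ) 2 := by
    intro n
    rw [mem_closedBall_zero_iff]
    by_contra hc
    exact Esc_disj ⟨0, not_le.mp hc⟩ (h.sub (hv n))
  obtain ⟨b, hb, φ, hφ, hlim2⟩ := (isCompact_closedBall (0 : ℂ) 2).tendsto_subseq hbd
  have h1 : Tendsto (fun n => fBasilica (v (φ n))) atTop (𝓝 (fBasilica b)) := (f_cont.tendsto b).comp hlim2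
  have h2 : Tendsto (fun n => fBasilica (v (φ n))) atTop (𝓝 w) := by
    simp only [hvu]; exact hlim.comp hφ.tendsto_atTop
  have hbw : fBasilica b = w := tendsto_nhds_unique h1 h2
  refine ⟨b, ?_, hbw⟩
  apply h.closure_sub
  · exact mem_closure_of_tendsto hlim2 (Eventually.of_forall fun n => hv _)
  · apply basin_of_f; rw [hbw]; exact hwB

lemma image_B0 : fBasilica '' B0 = B1 :=
  hB0.image.eq hB1 (z := -1) ⟨0, zero_mem, f_zero⟩ neg_one_mem

lemma image_B1 : fBasilica '' B1 = B0 :=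
  hB1.image.eq hB0 (z := 0) ⟨-1, neg_one_mem, f_neg_one⟩ zero_mem

/-- separation by a continuous real function. -/
lemma sep {D : Set ℂ} (h : IsPreconnected D) (g : ℂ → ℝ) (hg : Continuous g) (c : ℝ)
    (hc : ∀ z ∈ D, g z ≠ c) : (∀ z ∈ D, g z < c) ∨ (∀ z ∈ D, c < g z) := by
  by_contra! hh
  obtain ⟨⟨x, hx, hx'⟩, y, hy, hy'⟩ := hh
  obtain ⟨w, hw, hw'⟩ := h.intermediate_value hy hx hg.continuousOn ⟨hy', hx'⟩
  exact hc w hw hw'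

lemma B0_re : ∀ z ∈ B0, -a < z.re := by
  rcases sep hB0.conn Complex.re Complex.continuous_re (-a) (fun z hz => re_ne (hB0.sub hz)) with h | h
  · have := h 0 zero_mem
    have := a_gt
    simp at *
    linarith
  · exact h

lemma B1_re : ∀ z ∈ B1, z.re < -a := by
  rcases sep hB1.conn Complex.re Complex.continuous_re (-a) (fun z hz => re_ne (hB1.sub hz)) with h | h
  · exact h
  · have := h (-1) neg_one_mem
    have := a_lt
    simp at *
    linarith

lemma closure_le {D : Set ℂ} {g : ℂ → ℝ} (hg : Continuous g) {c : ℝ} (h : ∀ z ∈ D, g z < c) :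
    ∀ z ∈ closure D, g z ≤ c := fun _ hz =>
  closure_minimal (fun z hz => (h z hz).le) (isClosed_le hg continuous_const) hz

lemma closure_ge {D : Set ℂ} {g : ℂ → ℝ} (hg : Continuous g) {c : ℝ} (h : ∀ z ∈ D, c < g z) :
    ∀ z ∈ closure D, c ≤ g z := fun _ hz =>
  closure_minimal (fun z hz => (h z hz).le) (isClosed_le continuous_const hg) hz

lemma B01 {z : ℂ} (h0 : z ∈ closure B0) (h1 : z ∈ closure B1) : z = alphaFix :=
  closure_line (closure_mono hB0.sub h0)
    (le_antisymm (closure_le Complex.continuous_re B1_re z h1)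
      (closure_ge Complex.continuous_re B0_re z h0))

lemma M {A B : Set ℂ} (hA : IsBubble A) (hB : IsBubble B) (h : fBasilica '' A = fBasilica '' B) (hne : A ≠ B) :
    B = Neg.neg ⁻¹' A := by
  obtain ⟨x, hx⟩ := hA.ne
  have : fBasilica x ∈ fBasilica '' B := h ▸ ⟨x, hx, rfl⟩
  obtain ⟨y, hy, hxy⟩ := this
  rcases f_eq hxy with rfl | rfl
  · exact absurd (hA.eq hB hx hy) hne
  · exact hB.eq hA.neg hy (by simpa using hx)

lemma eventually_central {D : Set ℂ} (h : IsBubble D) :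
    ∃ n, ∀ m, n ≤ m → fBasilica^[m] '' D = B0 ∨ fBasilica^[m] '' D = B1 := by
  obtain ⟨z, hz⟩ := h.ne
  obtain ⟨n, hn⟩ := basin_enter (h.sub hz)
  refine ⟨n, fun m hm => ?_⟩
  have hbub : ∀ k, IsBubble (fBasilica^[k] '' D) := by
    intro k
    induction k with
    | zero => simpa using h
    | succ k ih => rw [Function.iterate_succ', Set.image_comp]; exact ih.image
  induction m, hm using Nat.le_induction with
  | base =>
    left
    apply (hbub n).eq hB0 ⟨z, hz, rfl⟩
    exact hB0.subset (convex_ball (0 : ℂ) (1 / 4)).isPreconnected (fun w hw => ball_basin hw)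
      zero_mem (by simp) hn
  | succ m hm ih =>
    rw [Function.iterate_succ', Set.image_comp]
    rcases ih with h | h <;> rw [h]
    · right; exact image_B0
    · left; exact image_B1

lemma N_aux (n : ℕ) : ∀ D, IsBubble D → (fBasilica^[n] '' D = B0 ∨ fBasilica^[n] '' D = B1) →
    alphaFix ∈ closure D → D = B0 ∨ D = B1 := by
  induction n with
  | zero => intro D _ h _; simpa using h
  | succ n ih =>
    intro D hD h hα
    rw [Function.iterate_succ, Set.image_comp] at h
    have h1 : alphaFix ∈ closure (fBasilica '' D) := by
      have := closure_f hα; rwa [f_alpha] at this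
    rcases ih _ hD.image h h1 with h2 | h2
    · by_cases hne : D = B1
      · right; exact hne
      · have := M hB1 hD (image_B1.trans h2.symm) (Ne.symm hne)
        rw [this, closure_neg'] at hα
        have := closure_le Complex.continuous_re B1_re _ hα
        rw [Complex.neg_re, alpha_re] at this
        have := a_gt
        linarith
    · by_cases hne : D = B0
      · left; exact hne
      · have := M hB0 hD (image_B0.trans h2.symm) (Ne.symm hne)
        left; rw [this, neg_B0]

lemma N {D : Set ℂ} (hD : IsBubble D) (h : alphaFix ∈ closure D) : D = B0 ∨ D = B1 := by
  obtain ⟨n, hn⟩ := eventually_central hD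
  exact N_aux n D hD (hn n le_rfl) h

lemma re_sq_sep {z : ℂ} (h : z ∈ basilicaBasin) : z.re ^ 2 - z.im ^ 2 ≠ a ^ 2 := by
  intro hz
  apply re_ne (basin_f h)
  rw [f_re, hz, a_sq]; ring

lemma real_B0 {z : ℂ} (hi : z.im = 0) (hr : z.re ^ 2 < a ^ 2) : z ∈ B0 := by
  have ha := a_gt
  have hz : z = ((z.re : ℝ) : ℂ) := Complex.ext (by simp) (by simp [hi])
  have himg : IsPreconnected ((fun y : ℝ => (y : ℂ)) '' {y | |y| < a}) := by
    apply IsPreconnected.image _ _ Complex.continuous_ofReal.continuousOn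
    have : {y : ℝ | |y| < a} = Set.Ioo (-a) a := by ext; simp [abs_lt]
    rw [this]; exact isPreconnected_Ioo
  apply hB0.subset himg _ zero_mem ⟨0, by simpa using by linarith, by simp⟩
  · exact ⟨z.re, abs_lt_of_sq_lt_sq hr (by linarith), hz.symm⟩
  · rintro _ ⟨y, hy, rfl⟩; exact real_basin hy

lemma L {A : Set ℂ} (hA : IsBubble A) (hne : A ≠ B0) {z : ℂ} (h1 : z ∈ closure A)
    (h2 : -z ∈ closure A) : False := by
  have ha := a_gt
  have cg : Continuous fun z : ℂ => z.re ^ 2 - z.im ^ 2 := by fun_prop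
  rcases sep hA.conn (fun z => z.re ^ 2 - z.im ^ 2) cg (a ^ 2)
    (fun z hz => re_sq_sep (hA.sub hz)) with h | h
  · -- middle region
    have hi : ∀ w ∈ A, w.im ≠ 0 := by
      intro w hw hw0
      have := h w hw
      simp only [hw0] at this
      exact hne (hA.eq hB0 hw (real_B0 hw0 (by linarith)))
    have him : z.im = 0 := by
      rcases sep hA.conn Complex.im Complex.continuous_im 0 hi with h | h
      · have e1 := closure_le Complex.continuous_im h _ h1
        have e2 := closure_le Complex.continuous_im h _ h2
        rw [Complex.neg_im] at e2; linarith
      · have e1 := closure_ge Complex.continuous_im h _ h1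
        have e2 := closure_ge Complex.continuous_im h _ h2
        rw [Complex.neg_im] at e2; linarith
    have hle := closure_le cg h _ h1
    simp only [him] at hle
    have hre : z.re ^ 2 = a ^ 2 := by
      apply le_antisymm (by linarith)
      by_contra hc
      have hz0 := real_B0 him (not_le.mp hc)
      exact hne (hA.eq hB0 (hA.closure_sub h1 (hB0.sub hz0)) hz0)
    have hboth : alphaFix ∈ closure A ∧ -alphaFix ∈ closure A := by
      rcases sq_eq_sq_iff_eq_or_eq_neg.mp hre with h | h
      · have : z = -alphaFix := Complex.ext (by simp [h, alpha_re]) (by simp [him, alpha_im])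
        subst this
        exact ⟨by simpa using h2, h1⟩
      · have : z = alphaFix := Complex.ext (by simp [h, alpha_re]) (by simp [him, alpha_im])
        subst this
        exact ⟨h1, h2⟩
    rcases N hA hboth.1 with h | h
    · exact hne h
    · rw [h] at hboth
      have := closure_le Complex.continuous_re B1_re _ hboth.2
      rw [Complex.neg_re, alpha_re] at this
      linarith
  · have hr : ∀ w ∈ A, w.re ≠ 0 := by
      intro w hw hw0
      have := h w hw
      simp only [hw0] at this
      nlinarith [sq_nonneg w.im]
    have hre : z.re = 0 := by
      rcases sep hA.conn Complex.re Complex.continuous_re 0 hr with h | h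
      · have e1 := closure_le Complex.continuous_re h _ h1
        have e2 := closure_le Complex.continuous_re h _ h2
        rw [Complex.neg_re] at e2; linarith
      · have e1 := closure_ge Complex.continuous_re h _ h1
        have e2 := closure_ge Complex.continuous_re h _ h2
        rw [Complex.neg_re] at e2; linarith
    have := closure_ge cg h _ h1
    simp only [hre] at this
    nlinarith [sq_nonneg z.im]

lemma main (n : ℕ) : ∀ A B : Set ℂ, IsBubble A → IsBubble B → A ≠ B →
    (fBasilica^[n] '' A = B0 ∨ fBasilica^[n] '' A = B1) → (fBasilica^[n] '' B = B0 ∨ fBasilica^[n] '' B = B1) →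
    (∀ x ∈ closure A ∩ closure B, fBasilica^[n] x = alphaFix) ∧
    (∀ x ∈ closure A ∩ closure B, ∀ y ∈ closure A ∩ closure B, x = y) := by
  induction n with
  | zero =>
    intro A B _ _ hne h1 h2
    simp only [Function.iterate_zero, Set.image_id, id] at *
    have key : ∀ x ∈ closure A ∩ closure B, x = alphaFix := by
      rintro x ⟨hx, hx'⟩
      rcases h1 with rfl | rfl <;> rcases h2 with rfl | rfl
      · exact absurd rfl hne
      · exact B01 hx hx'
      · exact B01 hx' hx
      · exact absurd rfl hne
    exact ⟨key, fun x hx y hy => (key x hx).trans (key y hy).symm⟩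
  | succ n ih =>
    intro A B hA hB hne h1 h2
    rw [Function.iterate_succ, Set.image_comp] at h1 h2
    by_cases he : fBasilica '' A = fBasilica '' B
    · have hAB := M hA hB he hne
      have hA0 : A ≠ B0 := by
        rintro rfl
        rw [neg_B0] at hAB
        exact hne hAB.symm
      have key : ∀ x ∈ closure A ∩ closure B, False := by
        rintro x ⟨hx, hx'⟩
        rw [hAB, closure_neg'] at hx'
        exact L hA hA0 hx hx'
      exact ⟨fun x hx => (key x hx).elim, fun x hx => (key x hx).elim⟩
    · obtain ⟨i1, i2⟩ := ih _ _ hA.image hB.image he h1 h2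
      refine ⟨fun x hx => ?_, fun x hx y hy => ?_⟩
      · rw [Function.iterate_succ_apply]
        exact i1 _ ⟨closure_f hx.1, closure_f hx.2⟩
      · rcases f_eq (i2 _ ⟨closure_f hx.1, closure_f hx.2⟩ _ ⟨closure_f hy.1, closure_f hy.2⟩)
          with h | h
        · exact h
        · exfalso
          subst h
          by_cases hA0 : A = B0
          · exact L hB (fun h => hne (hA0.trans h.symm)) hy.2 hx.2
          · exact L hA hA0 hy.1 hx.1

end Basilica

/-- For any two bubbles `A`, `B` of the basilica, exactly one of the following holds:
(1) their closures are disjoint; (2) their closures meet in exactly one point, which is an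
iterated preimage of the dividing fixed point `α`; (3) `A = B`. -/
theorem bubbles_touching_trichotomy (A B : Set ℂ) (hA : IsBubble A) (hB : IsBubble B) :
    (closure A ∩ closure B = ∅ ∧
      ¬ (∃ x : ℂ, closure A ∩ closure B = {x} ∧ ∃ n : ℕ, fBasilica^[n] x = alphaFix) ∧
      A ≠ B) ∨
    (closure A ∩ closure B ≠ ∅ ∧
      (∃ x : ℂ, closure A ∩ closure B = {x} ∧ ∃ n : ℕ, fBasilica^[n] x = alphaFix) ∧
      A ≠ B) ∨
    (closure A ∩ closure B ≠ ∅ ∧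
      ¬ (∃ x : ℂ, closure A ∩ closure B = {x} ∧ ∃ n : ℕ, fBasilica^[n] x = alphaFix) ∧
      A = B) := by
  by_cases hAB : A = B
  · right; right
    subst hAB
    have hne : (closure A).Nonempty := (IsBubble.ne hA).closure
    refine ⟨by simpa using hne.ne_empty, ?_, rfl⟩
    rintro ⟨x, hx, -⟩
    rw [Set.inter_self] at hx
    have hAx : A = {x} := by
      apply Set.Nonempty.subset_singleton_iff (IsBubble.ne hA) |>.mp
      rw [← hx]; exact subset_closure
    have := IsBubble.isOpen hA
    rw [hAx] at this
    exact not_isOpen_singleton x this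
  · obtain ⟨n, hn⟩ := Basilica.eventually_central hA
    obtain ⟨m, hm⟩ := Basilica.eventually_central hB
    obtain ⟨h1, h2⟩ := Basilica.main (max n m) A B hA hB hAB (hn _ (le_max_left _ _))
      (hm _ (le_max_right _ _))
    by_cases he : closure A ∩ closure B = ∅
    · left
      refine ⟨he, ?_, hAB⟩
      rintro ⟨x, hx, -⟩
      rw [he] at hx
      exact (Set.singleton_ne_empty x) hx.symm
    · right; left
      obtain ⟨x, hx⟩ := Set.nonempty_iff_ne_empty.mpr he
      refine ⟨he, ⟨x, ?_, _, h1 x hx⟩, hAB⟩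
      ext y
      constructor
      · intro hy; exact h2 y hy x hx
      · rintro rfl; exact hx
end

section
/- If (F_n)_{n≥0} is a sequence of pairwise distinct bubbles of the basilica polynomial f, then the Euclidean diameters of the F_n tend to 0 as n → ∞. -/
open Filter Topology

/-- A zero-free holomorphic function on a disk has a holomorphic logarithm. -/
lemma bas_exists_log {g : ℂ → ℂ} {c : ℂ} {r : ℝ} (hr : 0 < r)
    (hg : DifferentiableOn ℂ g (Metric.ball c r)) (h0 : ∀ z ∈ Metric.ball c r, g z ≠ 0) :
    ∃ L : ℂ → ℂ, DifferentiableOn ℂ L (Metric.ball c r) ∧ L c = 0 ∧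
      ∀ z ∈ Metric.ball c r, g z = g c * Complex.exp (L z) := by
  have hd : DifferentiableOn ℂ (fun z => deriv g z / g z) (Metric.ball c r) :=
    (hg.deriv Metric.isOpen_ball).div hg h0
  obtain ⟨L, hLc, hL⟩ := hd.isExactOn_ball.with_val_at c 0
  refine ⟨L, fun z hz => (hL z hz).differentiableAt.differentiableWithinAt, hLc, ?_⟩
  have hder : ∀ z ∈ Metric.ball c r,
      HasDerivAt (fun z => g z * Complex.exp (-L z)) 0 z := by
    intro z hz
    have h1 : HasDerivAt g (deriv g z) z :=
      (hg.differentiableAt (Metric.isOpen_ball.mem_nhds hz)).hasDerivAt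
    have h2 := h1.mul (hL z hz).neg.cexp
    refine HasDerivAt.congr_deriv (f := fun z => g z * Complex.exp (-L z)) h2 ?_
    have := h0 z hz
    have h3 : g z * (deriv g z / g z) = deriv g z := by field_simp
    have h4 : deriv g z * Complex.exp (-L z) +
        g z * (Complex.exp (-L z) * -(deriv g z / g z)) = 0 := by
      linear_combination -Complex.exp (-L z) * h3
    exact h4
  intro z hz
  have hconst : g z * Complex.exp (-L z) = g c * Complex.exp (-L c) := by
    refine Metric.isOpen_ball.is_const_of_deriv_eq_zero (f := fun z => g z * Complex.exp (-L z))
      (convex_ball c r).isPreconnected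
      (fun w hw => (hder w hw).differentiableAt.differentiableWithinAt)
      (fun w hw => (hder w hw).deriv) hz (Metric.mem_ball_self hr)
  rw [hLc] at hconst
  simp only [neg_zero, Complex.exp_zero, mul_one] at hconst
  rw [← hconst, mul_assoc, ← Complex.exp_add]
  simp

/-- A zero-free holomorphic function on a disk has a holomorphic square root. -/
lemma bas_exists_sqrt {g : ℂ → ℂ} {c : ℂ} {r : ℝ} (hr : 0 < r)
    (hg : DifferentiableOn ℂ g (Metric.ball c r)) (h0 : ∀ z ∈ Metric.ball c r, g z ≠ 0) :
    ∃ s : ℂ → ℂ, DifferentiableOn ℂ s (Metric.ball c r) ∧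
      ∀ z ∈ Metric.ball c r, s z ^ 2 = g z := by
  obtain ⟨L, hL, -, h⟩ := bas_exists_log hr hg h0
  refine ⟨fun z => (g c) ^ (2⁻¹ : ℂ) * Complex.exp (L z / 2), ?_, ?_⟩
  · exact (differentiableOn_const _).mul (hL.div_const 2).cexp
  · intro z hz
    rw [h z hz, mul_pow, ← Complex.exp_nat_mul]
    have := Complex.cpow_nat_inv_pow (g c) (n := 2) (by norm_num)
    push_cast at this
    rw [this]
    congr 2
    push_cast
    ring

/-- Harnack-type inequality. -/
lemma bas_harnack {L : ℂ → ℂ} {c : ℂ} {A : ℝ} (hA : 0 < A)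
    (hL : DifferentiableOn ℂ L (Metric.ball c 1)) (hLc : L c = 0)
    (hre : ∀ z ∈ Metric.ball c 1, (L z).re ≤ A) {z : ℂ} (hz : z ∈ Metric.ball c 1) :
    |(L z).re| ≤ dist z c * (2 * A - (L z).re) := by
  have hne : ∀ w ∈ Metric.ball c 1, 2 * (A : ℂ) - L w ≠ 0 := by
    intro w hw h
    have h1 := congrArg Complex.re h
    have h2 := hre w hw
    simp at h1
    linarith
  have hS : DifferentiableOn ℂ (fun w => L w / (2 * (A : ℂ) - L w)) (Metric.ball c 1) :=
    hL.div ((differentiableOn_const _).sub hL) hne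
  have hnorm : ∀ w ∈ Metric.ball c 1, ‖L w‖ ≤ ‖2 * (A : ℂ) - L w‖ := by
    intro w hw
    have h2 := hre w hw
    rw [← sq_le_sq₀ (norm_nonneg _) (norm_nonneg _), Complex.sq_norm, Complex.sq_norm,
      Complex.normSq_apply, Complex.normSq_apply]
    simp
    nlinarith
  have hmaps : Set.MapsTo (fun w => L w / (2 * (A : ℂ) - L w)) (Metric.ball c 1)
      (Metric.closedBall ((fun w => L w / (2 * (A : ℂ) - L w)) c) 1) := by
    intro w hw
    simp only [hLc, zero_div, mem_closedBall_zero_iff, norm_div]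
    exact div_le_one_of_le₀ (hnorm w hw) (norm_nonneg _)
  have hs := Complex.dist_le_div_mul_dist_of_mapsTo_ball hS hmaps hz
  simp only [hLc, zero_div, dist_zero_right, norm_div, div_one, one_mul] at hs
  have hpos : 0 < ‖2 * (A : ℂ) - L z‖ := norm_pos_iff.2 (hne z hz)
  rw [div_le_iff₀ hpos] at hs
  have ht : dist z c < 1 := hz
  have ht0 : 0 ≤ dist z c := dist_nonneg
  have hs2 : ‖L z‖ ^ 2 ≤ (dist z c * ‖2 * (A : ℂ) - L z‖) ^ 2 := by gcongr
  rw [mul_pow, Complex.sq_norm, Complex.sq_norm,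
      Complex.normSq_apply, Complex.normSq_apply] at hs2
  simp at hs2
  have h2 := hre z hz
  apply abs_le_of_sq_le_sq _ (by nlinarith)
  have : dist z c ^ 2 ≤ 1 := by nlinarith
  nlinarith [mul_nonneg (sub_nonneg.2 this) (mul_self_nonneg (L z).im)]

/-- Distortion: an injective bounded holomorphic function on the disk either has small image of the
smaller disk or has an image of a small disk containing a definite disk. -/
lemma bas_distortion {ε s : ℝ} (hε : 0 < ε) (hs : 0 < s) (hs3 : s ≤ 1 / 3) :
    ∃ δ > 0, ∀ φ : ℂ → ℂ, DifferentiableOn ℂ φ (Metric.ball 1 1) →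
      Set.InjOn φ (Metric.ball 1 1) → deriv φ 1 ≠ 0 →
      (∀ z ∈ Metric.ball (1 : ℂ) 1, ‖φ z‖ < 2) →
      (φ '' Metric.closedBall 1 (2 / 5) ⊆ Metric.closedBall (φ 1) ε) ∨
      (Metric.ball (φ 1) δ ⊆ φ '' Metric.closedBall 1 s) := by
  have hl5 : 0 < Real.log 5 := Real.log_pos (by norm_num)
  -- the threshold for the derivative
  obtain ⟨d, hd, hdd⟩ : ∃ d > 0, 3 / 7 * Real.log d + 4 / 7 * Real.log 5 ≤ Real.log ε := by
    refine ⟨Real.exp ((Real.log ε - 4 / 7 * Real.log 5) * (7 / 3)), Real.exp_pos _, ?_⟩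
    rw [Real.log_exp]
    linarith
  refine ⟨s * (d ^ 2 / 5) / 2, by positivity, ?_⟩
  intro φ hφ hinj hder hbd
  have h1 : (1 : ℂ) ∈ Metric.ball (1 : ℂ) 1 := Metric.mem_ball_self one_pos
  set q := dslope φ 1 with hq
  have hqd : DifferentiableOn ℂ q (Metric.ball 1 1) :=
    (Complex.differentiableOn_dslope (Metric.isOpen_ball.mem_nhds h1)).2 hφ
  have hq1 : q 1 = deriv φ 1 := dslope_same _ _
  have hqm : ∀ z, φ z - φ 1 = (z - 1) * q z := by
    intro z
    have := sub_smul_dslope φ 1 z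
    simpa [smul_eq_mul] using this.symm
  have hq0 : ∀ z ∈ Metric.ball (1 : ℂ) 1, q z ≠ 0 := by
    intro z hz h
    by_cases hz1 : z = 1
    · rw [hz1, hq1] at h
      exact hder h
    · have := hqm z
      rw [h, mul_zero, sub_eq_zero] at this
      exact hz1 (hinj hz h1 this)
  have hqb : ∀ z ∈ Metric.ball (1 : ℂ) 1, ‖q z‖ ≤ 4 := by
    intro z hz
    have := Complex.norm_dslope_le_div_of_mapsTo_ball (R₂ := 4) hφ (fun w hw => by
      rw [Metric.mem_closedBall, dist_eq_norm]
      have := norm_sub_le (φ w) (φ 1)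
      linarith [hbd w hw, hbd 1 h1]) hz
    simpa using this
  obtain ⟨L, hL, hL1, hLq⟩ := bas_exists_log one_pos hqd hq0
  have hlog : ∀ z ∈ Metric.ball (1 : ℂ) 1, Real.log ‖q z‖ = Real.log ‖q 1‖ + (L z).re := by
    intro z hz
    rw [hLq z hz, norm_mul, Complex.norm_exp,
      Real.log_mul (norm_ne_zero_iff.2 (hq0 1 h1)) (Real.exp_pos _).ne', Real.log_exp]
  have hlt : ∀ z ∈ Metric.ball (1 : ℂ) 1, Real.log ‖q z‖ < Real.log 5 := fun z hz =>
    Real.log_lt_log (norm_pos_iff.2 (hq0 z hz)) (by linarith [hqb z hz])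
  set A := Real.log 5 - Real.log ‖q 1‖ with hA
  have hApos : 0 < A := sub_pos.2 (hlt 1 h1)
  have hhar : ∀ z ∈ Metric.ball (1 : ℂ) 1, |(L z).re| ≤ dist z 1 * (2 * A - (L z).re) :=
    fun z hz => bas_harnack hApos hL hL1
      (fun w hw => by have := hlt w hw; rw [hlog w hw] at this; linarith) hz
  have hLA : ∀ z ∈ Metric.ball (1 : ℂ) 1, (L z).re < A := fun w hw => by
    have := hlt w hw; rw [hlog w hw] at this; linarith
  rcases le_or_gt ‖q 1‖ d with hsmall | hbig
  · left
    rintro _ ⟨z, hz, rfl⟩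
    have hz25 : dist z 1 ≤ 2 / 5 := hz
    have hzb : z ∈ Metric.ball (1 : ℂ) 1 := by
      rw [Metric.mem_ball]; linarith
    have hh := hhar z hzb
    have hle : (L z).re ≤ 4 / 7 * A := by
      have := le_abs_self (L z).re
      have h3 := hLA z hzb
      nlinarith
    have hqe : ‖q z‖ ≤ ε := by
      rw [← Real.log_le_log_iff (norm_pos_iff.2 (hq0 z hzb)) hε, hlog z hzb]
      have := Real.log_le_log (norm_pos_iff.2 (hq0 1 h1)) hsmall
      linarith
    rw [Metric.mem_closedBall, dist_eq_norm, hqm, norm_mul, ← dist_eq_norm]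
    nlinarith [norm_nonneg (q z)]
  · right
    have hsub : Metric.closedBall (1 : ℂ) s ⊆ Metric.ball 1 1 :=
      Metric.closedBall_subset_ball (by linarith)
    have hdc : DiffContOnCl ℂ φ (Metric.ball 1 s) := by
      refine DifferentiableOn.diffContOnCl ?_
      rw [closure_ball _ hs.ne']
      exact hφ.mono hsub
    refine hdc.ball_subset_image_closedBall hs ?_ ?_
    · intro z hz
      have hzs : dist z 1 = s := hz
      have hzb : z ∈ Metric.ball (1 : ℂ) 1 := by rw [Metric.mem_ball]; linarith
      have hh := hhar z hzb
      rw [hzs] at hh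
      have hge : -A ≤ (L z).re := by
        have := neg_abs_le (L z).re
        have h3 := hLA z hzb
        nlinarith
      have hqpos := norm_pos_iff.2 (hq0 1 h1)
      have : ‖q 1‖ ^ 2 / 5 ≤ ‖q z‖ := by
        rw [← Real.log_le_log_iff (by positivity) (norm_pos_iff.2 (hq0 z hzb)), hlog z hzb,
          Real.log_div (by positivity) (by norm_num), Real.log_pow]
        push_cast
        linarith
      rw [hqm, norm_mul, ← dist_eq_norm, hzs]
      have h4 : d ^ 2 / 5 ≤ ‖q 1‖ ^ 2 / 5 := by gcongr
      exact mul_le_mul_of_nonneg_left (h4.trans this) hs.le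
    · have : ∀ᶠ z in 𝓝[≠] (1 : ℂ), φ z ≠ φ 1 := by
        filter_upwards [self_mem_nhdsWithin,
          mem_nhdsWithin_of_mem_nhds (Metric.isOpen_ball.mem_nhds h1)] with z hz hz2 h
        exact hz (hinj hz2 h1 h)
      exact this.frequently.filter_mono nhdsWithin_le_nhds

lemma bas_f_apply (z : ℂ) : fBasilica z = z ^ 2 - 1 := rfl

lemma bas_f_cont : Continuous fBasilica := by
  unfold fBasilica
  fun_prop

lemma bas_f_ff (z : ℂ) : fBasilica (fBasilica z) = z ^ 2 * (z ^ 2 - 2) := by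
  simp only [bas_f_apply]
  ring

lemma bas_small_step {z : ℂ} (hz : ‖z‖ < 1 / 3) :
    ‖fBasilica (fBasilica z)‖ ≤ 3 / 4 * ‖z‖ := by
  rw [bas_f_ff, norm_mul, norm_pow]
  have h1 : ‖z ^ 2 - 2‖ ≤ ‖z‖ ^ 2 + 2 := by
    have := norm_sub_le (z ^ 2) 2
    simpa using this
  have h0 := norm_nonneg z
  have h2 : ‖z‖ ^ 2 * ‖z ^ 2 - 2‖ ≤ ‖z‖ ^ 2 * (‖z‖ ^ 2 + 2) := by gcongr
  have h3 : ‖z‖ ^ 2 ≤ 1 / 3 * ‖z‖ := by nlinarith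
  have h4 : ‖z‖ ^ 2 ≤ 1 / 9 := by nlinarith
  nlinarith

lemma bas_small_iter {z : ℂ} (hz : ‖z‖ < 1 / 3) (n : ℕ) :
    ‖fBasilica^[2 * n] z‖ ≤ (3 / 4) ^ n * ‖z‖ := by
  induction n with
  | zero => simp
  | succ n ih =>
    have hlt : ‖fBasilica^[2 * n] z‖ < 1 / 3 := by
      have : ((3 : ℝ) / 4) ^ n ≤ 1 := pow_le_one₀ (by norm_num) (by norm_num)
      nlinarith [norm_nonneg z]
    rw [show 2 * (n + 1) = 2 * n + 1 + 1 by ring, Function.iterate_succ_apply',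
      Function.iterate_succ_apply']
    refine (bas_small_step hlt).trans ?_
    rw [pow_succ]
    linarith

lemma bas_small_iter_lt {z : ℂ} (hz : ‖z‖ < 1 / 3) (n : ℕ) :
    ‖fBasilica^[2 * n] z‖ < 1 / 3 := by
  have := bas_small_iter hz n
  have h2 : ((3 : ℝ) / 4) ^ n ≤ 1 := pow_le_one₀ (by norm_num) (by norm_num)
  nlinarith [norm_nonneg z]

lemma bas_small_tendsto {z : ℂ} (hz : ‖z‖ < 1 / 3) :
    Tendsto (fun n => fBasilica^[2 * n] z) atTop (𝓝 0) := by
  refine squeeze_zero_norm (bas_small_iter hz) ?_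
  have := (tendsto_pow_atTop_nhds_zero_of_lt_one (r := (3 / 4 : ℝ)) (by norm_num)
    (by norm_num)).mul_const ‖z‖
  simpa using this

/-- Points of the basin are exactly those whose orbit enters the small disk. -/
lemma bas_mem_basin {z : ℂ} : z ∈ basilicaBasin ↔ ∃ m, ‖fBasilica^[m] z‖ < 1 / 3 := by
  constructor
  · rintro (h | h)
    · have := (h.norm).eventually_lt_const (u := 1 / 3) (by norm_num)
      obtain ⟨n, hn⟩ := this.exists
      exact ⟨_, hn⟩
    · have h2 : Tendsto (fun n => fBasilica (fBasilica^[2 * n] z)) atTop (𝓝 (fBasilica (-1))) :=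
        (bas_f_cont.tendsto _).comp h
      have := (h2.norm).eventually_lt_const (u := 1 / 3) (by norm_num [bas_f_apply])
      obtain ⟨n, hn⟩ := this.exists
      refine ⟨2 * n + 1, ?_⟩
      rwa [Function.iterate_succ_apply']
  · rintro ⟨m, hm⟩
    have h := bas_small_tendsto hm
    rcases Nat.even_or_odd' m with ⟨k, rfl | rfl⟩
    · left
      rw [← tendsto_add_atTop_iff_nat k]
      refine h.congr fun n => ?_
      rw [← Function.iterate_add_apply]
      congr 2
      ring
    · right
      have h2 := (bas_f_cont.tendsto _).comp h
      rw [← tendsto_add_atTop_iff_nat (k + 1)]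
      have h3 : fBasilica 0 = -1 := by simp [bas_f_apply]
      rw [h3] at h2
      refine h2.congr fun n => ?_
      simp only [Function.comp]
      rw [← Function.iterate_add_apply, ← Function.iterate_succ_apply' fBasilica]
      have e : (2 * n + (2 * k + 1)).succ = 2 * (n + (k + 1)) := by lia
      rw [e]

lemma bas_iter_cont (m : ℕ) : Continuous (fBasilica^[m]) := bas_f_cont.iterate m

lemma bas_basin_open : IsOpen basilicaBasin := by
  have : basilicaBasin = ⋃ m, {z | ‖fBasilica^[m] z‖ < 1 / 3} := by
    ext z
    simp [bas_mem_basin]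
  rw [this]
  exact isOpen_iUnion fun m => isOpen_lt (bas_iter_cont m).norm continuous_const

lemma bas_mem_f {z : ℂ} : fBasilica z ∈ basilicaBasin ↔ z ∈ basilicaBasin := by
  rw [bas_mem_basin, bas_mem_basin]
  constructor
  · rintro ⟨m, hm⟩
    exact ⟨m + 1, by rwa [Function.iterate_succ_apply]⟩
  · rintro ⟨m, hm⟩
    refine ⟨m + 1, ?_⟩
    rw [← Function.iterate_succ_apply]
    have := bas_small_iter_lt hm 1
    rw [← Function.iterate_add_apply] at this
    have e : (m + 1).succ = 2 * 1 + m := by lia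
    rwa [e]

lemma bas_mem_iter {z : ℂ} (n : ℕ) : fBasilica^[n] z ∈ basilicaBasin ↔ z ∈ basilicaBasin := by
  induction n with
  | zero => simp
  | succ n ih => rw [Function.iterate_succ_apply', bas_mem_f, ih]

lemma bas_mem_neg {z : ℂ} : -z ∈ basilicaBasin ↔ z ∈ basilicaBasin := by
  rw [← bas_mem_f, ← bas_mem_f (z := z)]
  simp [bas_f_apply]

/-- The central bubble. -/
def basU0 : Set ℂ := connectedComponentIn basilicaBasin 0

/-- The bubble of `-1`. -/
def basUm : Set ℂ := connectedComponentIn basilicaBasin (-1)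

lemma bas_small_mem {z : ℂ} (hz : ‖z‖ < 1 / 3) : z ∈ basilicaBasin :=
  bas_mem_basin.2 ⟨0, hz⟩

lemma bas_zero_mem : (0 : ℂ) ∈ basilicaBasin := bas_small_mem (by norm_num)

lemma bas_neg_one_mem : (-1 : ℂ) ∈ basilicaBasin := by
  rw [← bas_mem_f]
  convert bas_zero_mem
  norm_num [bas_f_apply]

lemma bas_U0_sub : basU0 ⊆ basilicaBasin := connectedComponentIn_subset _ _

lemma bas_Um_sub : basUm ⊆ basilicaBasin := connectedComponentIn_subset _ _

lemma bas_zero_U0 : (0 : ℂ) ∈ basU0 := mem_connectedComponentIn bas_zero_mem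

lemma bas_neg_one_Um : (-1 : ℂ) ∈ basUm := mem_connectedComponentIn bas_neg_one_mem

lemma bas_small_U0 {z : ℂ} (hz : ‖z‖ < 1 / 3) : z ∈ basU0 := by
  have hs : Metric.ball (0 : ℂ) (1 / 3) ⊆ basU0 :=
    (convex_ball _ _).isPreconnected.subset_connectedComponentIn
      (Metric.mem_ball_self (by norm_num))
      (fun w hw => bas_small_mem (by simpa using hw))
  exact hs (by simpa using hz)

lemma bas_U0_open : IsOpen basU0 := bas_basin_open.connectedComponentIn

lemma bas_Um_open : IsOpen basUm := bas_basin_open.connectedComponentIn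

/-- Connected subsets of the basin meeting a bubble are contained in it. -/
lemma bas_sub_comp {G : Set ℂ} (hG : IsPreconnected G) (hGB : G ⊆ basilicaBasin) {x z : ℂ}
    (hx : x ∈ G) (hxz : x ∈ connectedComponentIn basilicaBasin z) :
    G ⊆ connectedComponentIn basilicaBasin z := by
  rw [connectedComponentIn_eq hxz]
  exact hG.subset_connectedComponentIn hx hGB

/-- Points of the central bubble tend to `0` at even times. -/
lemma bas_U0_even {z : ℂ} (hz : z ∈ basU0) : ∃ n, ‖fBasilica^[2 * n] z‖ < 1 / 3 := by
  set u : Set ℂ := ⋃ n, {z | ‖fBasilica^[2 * n] z‖ < 1 / 3} with hu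
  set v : Set ℂ := ⋃ n, {z | ‖fBasilica^[2 * n + 1] z‖ < 1 / 3} with hv
  have huo : IsOpen u :=
    isOpen_iUnion fun m => isOpen_lt (bas_iter_cont _).norm continuous_const
  have hvo : IsOpen v :=
    isOpen_iUnion fun m => isOpen_lt (bas_iter_cont _).norm continuous_const
  have hdis : Disjoint u v := by
    rw [Set.disjoint_left]
    intro w hwu hwv
    simp only [hu, hv, Set.mem_iUnion, Set.mem_ofPred_eq] at hwu hwv
    obtain ⟨n, hn⟩ := hwu
    obtain ⟨k, hk⟩ := hwv
    have h1 := bas_small_iter_lt hn k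
    have h2 := bas_small_iter_lt hk n
    rw [← Function.iterate_add_apply] at h1 h2
    rw [show 2 * n + (2 * k + 1) = (2 * k + 2 * n) + 1 by ring,
      Function.iterate_succ_apply', bas_f_apply] at h2
    set y := fBasilica^[2 * k + 2 * n] w
    have h3 : ‖(1 : ℂ)‖ ≤ ‖y ^ 2‖ + ‖y ^ 2 - 1‖ := by
      have := norm_sub_le (y ^ 2) (y ^ 2 - 1)
      simpa using this
    rw [norm_pow, norm_one] at h3
    nlinarith [norm_nonneg y]
  have hcov : basU0 ⊆ u ∪ v := by
    intro w hw
    obtain ⟨m, hm⟩ := bas_mem_basin.1 (bas_U0_sub hw)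
    rcases Nat.even_or_odd' m with ⟨k, rfl | rfl⟩
    · exact Or.inl (Set.mem_iUnion.2 ⟨k, hm⟩)
    · exact Or.inr (Set.mem_iUnion.2 ⟨k, hm⟩)
  have := IsPreconnected.subset_left_of_subset_union huo hvo hdis hcov
    ⟨0, bas_zero_U0, Set.mem_iUnion.2 ⟨0, by norm_num⟩⟩ isPreconnected_connectedComponentIn
  simpa [hu] using this hz

lemma bas_trap {a : ℝ} (ha0 : 0 < a) (ha : a ^ 2 = 1 - a) (n : ℕ) : ∀ G : Set ℂ,
    IsPreconnected G → (0 : ℂ) ∈ G → (∀ z ∈ G, ‖fBasilica^[2 * n] z‖ < a) → ∀ z ∈ G, ‖z‖ < a := by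
  induction n with
  | zero => intro G _ _ h; simpa using h
  | succ n ih =>
    intro G hG h0 h z hz
    have hff : ∀ z ∈ G, ‖fBasilica (fBasilica z)‖ < a := by
      intro z hz
      refine ih ((fBasilica ∘ fBasilica) '' G)
        (hG.image _ (bas_f_cont.comp bas_f_cont).continuousOn)
        ⟨0, h0, by norm_num [bas_f_apply]⟩ ?_ _ ⟨z, hz, rfl⟩
      rintro _ ⟨w, hw, rfl⟩
      have := h w hw
      rwa [show 2 * (n + 1) = 2 * n + 1 + 1 by ring, Function.iterate_succ_apply,
        Function.iterate_succ_apply] at this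
    by_contra hza
    push Not at hza
    have := hG.intermediate_value h0 hz (f := fun w : ℂ => ‖w‖) continuous_norm.continuousOn
    obtain ⟨w, hw, hwa⟩ := this (show a ∈ Set.Icc ‖(0 : ℂ)‖ ‖z‖ from ⟨by simpa using ha0.le, hza⟩)
    have h1 := hff w hw
    simp only at hwa
    rw [bas_f_ff, norm_mul, norm_pow, hwa] at h1
    have h2 : 2 - a ^ 2 ≤ ‖w ^ 2 - 2‖ := by
      have := norm_sub_norm_le 2 (w ^ 2)
      rw [norm_pow, hwa, norm_sub_rev] at this
      simpa using this
    nlinarith [sq_nonneg a]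

lemma bas_U0_norm {a : ℝ} (ha0 : 1 / 3 < a) (ha : a ^ 2 = 1 - a) {p : ℂ} (hp : p ∈ basU0) :
    ‖p‖ < a := by
  have hpc : IsPathConnected basU0 := by
    rw [← bas_U0_open.isConnected_iff_isPathConnected]
    exact isConnected_connectedComponentIn_iff.2 bas_zero_mem
  obtain ⟨γ, hγ⟩ := hpc.joinedIn 0 bas_zero_U0 p hp
  have hcomp : IsCompact (Set.range γ) := isCompact_range γ.continuous
  obtain ⟨n, hn⟩ := hcomp.elim_directed_cover (fun n => {z | ‖fBasilica^[2 * n] z‖ < 1 / 3})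
    (fun n => isOpen_lt (bas_iter_cont _).norm continuous_const)
    (by
      rintro _ ⟨t, rfl⟩
      exact Set.mem_iUnion.2 (bas_U0_even (hγ t)))
    (by
      refine Monotone.directed_le (monotone_nat_of_le_succ fun n z hz => ?_)
      have := bas_small_iter_lt hz 1
      rw [← Function.iterate_add_apply] at this
      rwa [Set.mem_ofPred_eq, show 2 * (n + 1) = 2 * 1 + 2 * n by ring])
  refine bas_trap (by linarith) ha n (Set.range γ) ?_ ⟨0, γ.source⟩ ?_ p ⟨1, γ.target⟩
  · exact isPreconnected_range γ.continuous
  · intro z hz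
    have h1 : ‖fBasilica^[2 * n] z‖ < 1 / 3 := hn hz
    linarith

lemma bas_exists_a : ∃ a : ℝ, 3 / 5 < a ∧ a < 5 / 8 ∧ a ^ 2 = 1 - a := by
  refine ⟨(√5 - 1) / 2, ?_, ?_, ?_⟩
  · have : (2.2 : ℝ) < √5 := Real.lt_sqrt_of_sq_lt (by norm_num)
    linarith
  · have : √5 < (2.25 : ℝ) := by rw [Real.sqrt_lt' (by norm_num)]; norm_num
    linarith
  · have := Real.sq_sqrt (show (0 : ℝ) ≤ 5 by norm_num)
    nlinarith

/-- The principal inverse branch of `f`. -/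
noncomputable def basSq (w : ℂ) : ℂ := (1 + w) ^ (2⁻¹ : ℂ)

/-- The bubble of `1`, as the image of the central bubble under the principal branch. -/
def basU1 : Set ℂ := basSq '' basU0

lemma bas_f_Sq (w : ℂ) : fBasilica (basSq w) = w := by
  have := Complex.cpow_nat_inv_pow (1 + w) (n := 2) (by norm_num)
  push_cast at this
  rw [bas_f_apply, basSq, this]
  ring

lemma bas_Sq_f {x : ℂ} (hx : 0 < x.re) : basSq (fBasilica x) = x := by
  rw [bas_f_apply, basSq, show 1 + (x ^ 2 - 1) = x ^ 2 by ring]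
  exact Complex.sq_cpow_two_inv hx

lemma bas_Sq_contOn : ContinuousOn basSq basU0 := by
  obtain ⟨a, ha1, ha2, ha⟩ := bas_exists_a
  intro w hw
  have hn := bas_U0_norm (by linarith) ha hw
  refine ContinuousAt.continuousWithinAt ?_
  unfold basSq
  refine ContinuousAt.cpow (by fun_prop) (by fun_prop) ?_
  left
  have := Complex.abs_re_le_norm w
  have h2 := neg_abs_le w.re
  simp only [Complex.add_re, Complex.one_re]
  linarith

lemma bas_U1_conn : IsPreconnected basU1 :=
  IsPreconnected.image isPreconnected_connectedComponentIn _ bas_Sq_contOn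

lemma bas_U1_sub : basU1 ⊆ basilicaBasin := by
  rintro _ ⟨w, hw, rfl⟩
  rw [← bas_mem_f, bas_f_Sq]
  exact bas_U0_sub hw

lemma bas_re_sq {a : ℝ} (ha0 : 1 / 3 < a) (ha : a ^ 2 = 1 - a) {x : ℂ}
    (hx : fBasilica x ∈ basU0) : a ^ 2 < x.re ^ 2 := by
  have hn := bas_U0_norm ha0 ha hx
  have h1 := Complex.abs_re_le_norm (fBasilica x)
  have h2 := neg_abs_le (fBasilica x).re
  have h3 : (fBasilica x).re = x.re ^ 2 - x.im ^ 2 - 1 := by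
    simp [bas_f_apply, pow_two]
  nlinarith [sq_nonneg x.im]

lemma bas_U1_ball : basU1 ⊆ Metric.closedBall 1 (2 / 5) := by
  obtain ⟨a, ha1, ha2, ha⟩ := bas_exists_a
  rintro _ ⟨w, hw, rfl⟩
  have hf : fBasilica (basSq w) ∈ basU0 := by rwa [bas_f_Sq]
  have hre := bas_re_sq (by linarith) ha hf
  have hre0 : 0 ≤ (basSq w).re := by
    rw [basSq, Complex.cpow_inv_two_re]
    exact Real.sqrt_nonneg _
  have hre1 : a < (basSq w).re := lt_of_pow_lt_pow_left₀ 2 hre0 hre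
  have hn := bas_U0_norm (by linarith) ha hf
  set x := basSq w
  have h1 : ‖fBasilica x‖ = ‖x - 1‖ * ‖x + 1‖ := by
    rw [← norm_mul, bas_f_apply]
    congr 1
    ring
  have h2 : 1 + a < ‖x + 1‖ := by
    have h3 := Complex.abs_re_le_norm (x + 1)
    have h4 := le_abs_self (x + 1).re
    simp only [Complex.add_re, Complex.one_re] at h3 h4
    linarith
  rw [Metric.mem_closedBall, dist_eq_norm]
  by_contra hcon
  push Not at hcon
  nlinarith

lemma bas_Um_of {x : ℂ} (hx : fBasilica x ∈ basU0) (hre : x.re < 0) : x ∈ basUm := by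
  have hpre : IsPreconnected ((fun w => -basSq w) '' basU0) :=
    IsPreconnected.image isPreconnected_connectedComponentIn _ bas_Sq_contOn.neg
  have hsub : (fun w => -basSq w) '' basU0 ⊆ basilicaBasin := by
    rintro _ ⟨w, hw, rfl⟩
    exact bas_mem_neg.2 (bas_U1_sub ⟨w, hw, rfl⟩)
  have h1 : (-1 : ℂ) ∈ (fun w => -basSq w) '' basU0 := ⟨0, bas_zero_U0, by simp [basSq]⟩
  refine hpre.subset_connectedComponentIn h1 hsub ⟨fBasilica x, hx, ?_⟩
  have h2 := bas_Sq_f (x := -x) (by simpa using hre)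
  have h3 : fBasilica (-x) = fBasilica x := by simp [bas_f_apply]
  rw [h3] at h2
  simp [h2]

lemma bas_U0_neg {x : ℂ} (hx : x ∈ basU0) : -x ∈ basU0 := by
  have hpre : IsPreconnected ((fun w : ℂ => -w) '' basU0) :=
    IsPreconnected.image isPreconnected_connectedComponentIn _ continuous_neg.continuousOn
  have hsub : (fun w : ℂ => -w) '' basU0 ⊆ basilicaBasin := by
    rintro _ ⟨w, hw, rfl⟩
    exact bas_mem_neg.2 (bas_U0_sub hw)
  exact hpre.subset_connectedComponentIn ⟨0, bas_zero_U0, by simp⟩ hsub ⟨x, hx, rfl⟩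

lemma bas_f_open : IsOpenMap fBasilica := by
  have h1 := (Complex.isOpenQuotientMap_pow 2).isOpenMap
  have h2 : IsOpenMap (fun z : ℂ => z - 1) := (Homeomorph.subRight (1 : ℂ)).isOpenMap
  exact h2.comp h1

/-- The preimage of the bubble of `-1` is the central bubble. -/
lemma bas_pre_Um {x : ℂ} (hx : fBasilica x ∈ basUm) : x ∈ basU0 := by
  set P : Set ℂ := fBasilica ⁻¹' basUm with hP
  have hPo : IsOpen P := bas_Um_open.preimage bas_f_cont
  have hQo : IsOpen (P \ basU0) := by
    have : P \ basU0 = ⋃ y ∈ P \ basU0, (P ∩ connectedComponentIn basilicaBasin y) := by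
      ext y
      simp only [Set.mem_iUnion, exists_prop]
      constructor
      · intro hy
        refine ⟨y, hy, hy.1, mem_connectedComponentIn ?_⟩
        exact bas_mem_f.1 (bas_Um_sub hy.1)
      · rintro ⟨w, hw, hyP, hyw⟩
        refine ⟨hyP, fun hy0 => hw.2 ?_⟩
        have hwB : w ∈ basilicaBasin := bas_mem_f.1 (bas_Um_sub hw.1)
        have e1 := connectedComponentIn_eq hyw
        have e2 : basU0 = connectedComponentIn basilicaBasin y := connectedComponentIn_eq hy0
        rw [e2, ← e1]
        exact mem_connectedComponentIn hwB
    rw [this]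
    exact isOpen_biUnion fun y _ => hPo.inter bas_basin_open.connectedComponentIn
  have hdis : Disjoint (fBasilica '' (P ∩ basU0)) (fBasilica '' (P \ basU0)) := by
    rw [Set.disjoint_left]
    rintro _ ⟨y, hy, rfl⟩ ⟨w, hw, hwy⟩
    simp only [bas_f_apply, sub_left_inj] at hwy
    rcases sq_eq_sq_iff_eq_or_eq_neg.1 hwy with h | h
    · exact hw.2 (h ▸ hy.2)
    · exact hw.2 (h ▸ bas_U0_neg hy.2)
  have hcov : basUm ⊆ fBasilica '' (P ∩ basU0) ∪ fBasilica '' (P \ basU0) := by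
    intro y hy
    have hs : basSq y ∈ P := by rw [hP, Set.mem_preimage, bas_f_Sq]; exact hy
    by_cases h0 : basSq y ∈ basU0
    · exact Or.inl ⟨_, ⟨hs, h0⟩, bas_f_Sq y⟩
    · exact Or.inr ⟨_, ⟨hs, h0⟩, bas_f_Sq y⟩
  have hf0 : fBasilica 0 = -1 := by simp [bas_f_apply]
  have hsub := IsPreconnected.subset_left_of_subset_union
    (bas_f_open _ (hPo.inter bas_U0_open)) (bas_f_open _ hQo) hdis hcov
    ⟨-1, bas_neg_one_Um, 0, ⟨by rw [hP, Set.mem_preimage, hf0]; exact bas_neg_one_Um,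
      bas_zero_U0⟩, hf0⟩ isPreconnected_connectedComponentIn
  by_contra hx0
  exact Set.disjoint_left.1 hdis (hsub hx) ⟨x, ⟨hx, hx0⟩, rfl⟩

lemma bas_ball_U1 : Metric.closedBall 1 (1 / 10) ⊆ basU1 := by
  intro x hx
  rw [Metric.mem_closedBall, dist_eq_norm] at hx
  have hre : 0 < x.re := by
    have h3 := Complex.abs_re_le_norm (x - 1)
    have h4 := neg_abs_le (x - 1).re
    simp only [Complex.sub_re, Complex.one_re] at h3 h4
    linarith
  refine ⟨fBasilica x, bas_small_U0 ?_, bas_Sq_f hre⟩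
  have h1 : ‖fBasilica x‖ = ‖x - 1‖ * ‖x + 1‖ := by
    rw [← norm_mul, bas_f_apply]
    congr 1
    ring
  have h2 : ‖x + 1‖ ≤ ‖x - 1‖ + 2 := by
    have := norm_add_le (x - 1) 2
    rw [show x - 1 + 2 = x + 1 by ring] at this
    simpa using this
  rw [h1]
  nlinarith [norm_nonneg (x - 1), norm_nonneg (x + 1)]

/-- Inverse branches of `f^n` on the disk `ball 1 1`. -/
def BasBranch (n : ℕ) (φ : ℂ → ℂ) : Prop :=
  DifferentiableOn ℂ φ (Metric.ball 1 1) ∧ ∀ z ∈ Metric.ball (1 : ℂ) 1, fBasilica^[n] (φ z) = z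

lemma bas_iter_zero (n : ℕ) : fBasilica^[n] 0 = 0 ∨ fBasilica^[n] 0 = -1 := by
  induction n with
  | zero => simp
  | succ n ih =>
    rw [Function.iterate_succ_apply']
    rcases ih with h | h <;> rw [h] <;> simp [bas_f_apply]

lemma bas_branch_ne {n : ℕ} {φ : ℂ → ℂ} (h : BasBranch n φ) {z : ℂ}
    (hz : z ∈ Metric.ball (1 : ℂ) 1) : φ z ≠ -1 := by
  intro he
  have h1 := h.2 z hz
  have h0 : fBasilica^[n + 1] 0 = z := by
    rw [Function.iterate_succ_apply, ← h1, he]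
    simp [bas_f_apply]
  rw [Metric.mem_ball, ← h0, dist_eq_norm] at hz
  rcases bas_iter_zero (n + 1) with h2 | h2 <;> rw [h2] at hz <;> norm_num at hz

lemma bas_branch_inj {n : ℕ} {φ : ℂ → ℂ} (h : BasBranch n φ) :
    Set.InjOn φ (Metric.ball 1 1) := by
  intro z hz w hw hzw
  rw [← h.2 z hz, ← h.2 w hw, hzw]

lemma bas_iter_bound (n : ℕ) : ∀ z : ℂ, ‖fBasilica^[n] z‖ < 2 → ‖z‖ < 2 := by
  induction n with
  | zero => intro z h; simpa using h
  | succ n ih =>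
    intro z h
    rw [Function.iterate_succ_apply] at h
    have h1 := ih _ h
    rw [bas_f_apply] at h1
    have h2 : ‖z ^ 2‖ ≤ ‖z ^ 2 - 1‖ + 1 := by
      have := norm_add_le (z ^ 2 - 1) 1
      simpa using this
    rw [norm_pow] at h2
    nlinarith [norm_nonneg z]

lemma bas_branch_bound {n : ℕ} {φ : ℂ → ℂ} (h : BasBranch n φ) {z : ℂ}
    (hz : z ∈ Metric.ball (1 : ℂ) 1) : ‖φ z‖ < 2 := by
  apply bas_iter_bound n
  rw [h.2 z hz]
  rw [Metric.mem_ball, dist_eq_norm] at hz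
  have := norm_add_le (z - 1) 1
  simp only [sub_add_cancel, norm_one] at this
  linarith

lemma bas_f_diff : Differentiable ℂ fBasilica := by
  unfold fBasilica
  fun_prop

lemma bas_branch_deriv {n : ℕ} {φ : ℂ → ℂ} (h : BasBranch n φ) : deriv φ 1 ≠ 0 := by
  intro h0
  have h1 : (1 : ℂ) ∈ Metric.ball (1 : ℂ) 1 := Metric.mem_ball_self one_pos
  have hd : HasDerivAt φ (deriv φ 1) 1 :=
    (h.1.differentiableAt (Metric.isOpen_ball.mem_nhds h1)).hasDerivAt
  have hc := ((bas_f_diff.iterate n) (φ 1)).hasDerivAt.comp 1 hd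
  rw [h0, mul_zero] at hc
  have hid : HasDerivAt (fBasilica^[n] ∘ φ) 1 1 := by
    refine (hasDerivAt_id (1 : ℂ)).congr_of_eventuallyEq ?_
    filter_upwards [Metric.isOpen_ball.mem_nhds h1] with z hz
    exact h.2 z hz
  exact zero_ne_one (hc.unique hid)

/-- Lifting a connected set through inverse branches. -/
lemma bas_lift (n : ℕ) : ∀ F : Set ℂ, IsPreconnected F →
    (∀ z ∈ F, fBasilica^[n] z ∈ Metric.closedBall (1 : ℂ) (2 / 5)) →
    ∃ φ, BasBranch n φ ∧ F ⊆ φ '' Metric.closedBall 1 (2 / 5) := by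
  have hKb : Metric.closedBall (1 : ℂ) (2 / 5) ⊆ Metric.ball 1 1 :=
    Metric.closedBall_subset_ball (by norm_num)
  induction n with
  | zero =>
    intro F _ h
    exact ⟨id, ⟨differentiableOn_id, fun z _ => rfl⟩, fun z hz => ⟨z, h z hz, rfl⟩⟩
  | succ n ih =>
    intro F hF h
    obtain ⟨φ, hφ, hsub⟩ := ih (fBasilica '' F) (hF.image _ bas_f_cont.continuousOn) (by
      rintro _ ⟨w, hw, rfl⟩
      exact h w hw)
    obtain ⟨ψ, hψ, hsq⟩ := bas_exists_sqrt (g := fun z => 1 + φ z) one_pos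
      ((differentiableOn_const _).add hφ.1) (fun z hz h0 => bas_branch_ne hφ hz (by
        linear_combination h0))
    have hψb : BasBranch (n + 1) ψ := ⟨hψ, fun z hz => by
      rw [Function.iterate_succ_apply, bas_f_apply, hsq z hz, add_sub_cancel_left, hφ.2 z hz]⟩
    have hψb' : BasBranch (n + 1) (fun z => -ψ z) := ⟨hψ.neg, fun z hz => by
      rw [Function.iterate_succ_apply, bas_f_apply, neg_sq, hsq z hz, add_sub_cancel_left,
        hφ.2 z hz]⟩
    have hcl : ∀ χ : ℂ → ℂ, DifferentiableOn ℂ χ (Metric.ball 1 1) →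
        IsClosed (χ '' Metric.closedBall 1 (2 / 5)) := fun χ hχ =>
      ((isCompact_closedBall _ _).image_of_continuousOn (hχ.continuousOn.mono hKb)).isClosed
    have hor := isPreconnected_iff_subset_of_disjoint_closed.1 hF _ _ (hcl ψ hψ)
      (hcl _ hψ.neg) (by
        intro x hx
        obtain ⟨w, hw, hwx⟩ := hsub ⟨x, hx, rfl⟩
        have h2 : x ^ 2 = ψ w ^ 2 := by
          rw [hsq w (hKb hw), hwx, bas_f_apply]
          ring
        rcases sq_eq_sq_iff_eq_or_eq_neg.1 h2 with h3 | h3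
        · exact Or.inl ⟨w, hw, h3.symm⟩
        · exact Or.inr ⟨w, hw, h3.symm⟩) (by
        rw [Set.eq_empty_iff_forall_notMem]
        rintro x ⟨-, ⟨w, hw, rfl⟩, ⟨v, hv, hvw⟩⟩
        have hvw' : -ψ v = ψ w := hvw
        have e1 := hsq w (hKb hw)
        have e2 := hsq v (hKb hv)
        have e3 : φ v = φ w := by
          have : ψ v ^ 2 = ψ w ^ 2 := by rw [← hvw', neg_sq]
          rw [e1, e2] at this
          exact add_left_cancel this
        have e4 := bas_branch_inj hφ (hKb hv) (hKb hw) e3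
        subst e4
        have e5 : ψ v = 0 := by linear_combination (-1 / 2) * hvw'
        rw [e5] at e1
        exact bas_branch_ne hφ (hKb hv) (by linear_combination -e1))
    rcases hor with h1 | h1
    · exact ⟨ψ, hψb, h1⟩
    · exact ⟨_, hψb', h1⟩

/-- Every bubble except the two periodic ones is the image of the bubble of `1` under an inverse
branch. -/
lemma bas_bubble {F : Set ℂ} (hF : IsBubble F) (h0 : F ≠ basU0) (hm : F ≠ basUm) :
    ∃ n φ, BasBranch n φ ∧ F = φ '' basU1 := by
  obtain ⟨a, ha1, ha2, ha⟩ := bas_exists_a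
  obtain ⟨z, hzB, rfl⟩ := hF
  set F := connectedComponentIn basilicaBasin z with hFdef
  have hzF : z ∈ F := mem_connectedComponentIn hzB
  have hFB : F ⊆ basilicaBasin := connectedComponentIn_subset _ _
  have hFpre : IsPreconnected F := isPreconnected_connectedComponentIn
  have himg : ∀ m, IsPreconnected (fBasilica^[m] '' F) := fun m =>
    hFpre.image _ (bas_iter_cont m).continuousOn
  have hex : ∃ m, fBasilica^[m] z ∈ basU0 := by
    obtain ⟨m, hm⟩ := bas_mem_basin.1 hzB
    exact ⟨m, bas_small_U0 hm⟩
  classical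
  obtain ⟨m, hmU, hmin⟩ : ∃ m, fBasilica^[m] z ∈ basU0 ∧
      ∀ k < m, fBasilica^[k] z ∉ basU0 :=
    ⟨Nat.find hex, Nat.find_spec hex, fun k hk => Nat.find_min hex hk⟩
  cases m with
  | zero =>
    exact absurd (connectedComponentIn_eq (y := z) hmU).symm h0
  | succ n =>
    have hall : ∀ x ∈ F, fBasilica (fBasilica^[n] x) ∈ basU0 := by
      intro x hx
      rw [← Function.iterate_succ_apply' fBasilica]
      refine bas_sub_comp (himg (n + 1)) ?_ ⟨z, hzF, rfl⟩ hmU ⟨x, hx, rfl⟩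
      rintro _ ⟨w, hw, rfl⟩
      exact (bas_mem_iter _).2 (hFB hw)
    have hne : ∀ x ∈ F, (fBasilica^[n] x).re ≠ 0 := by
      intro x hx h
      have := bas_re_sq (by linarith) ha (hall x hx)
      rw [h] at this
      nlinarith
    have hzre : 0 < (fBasilica^[n] z).re := by
      by_contra hcon
      have hlt : (fBasilica^[n] z).re < 0 := lt_of_le_of_ne (not_lt.1 hcon) (hne z hzF)
      have hUm := bas_Um_of (hall z hzF) hlt
      cases n with
      | zero => exact hm (connectedComponentIn_eq (y := z) hUm).symm
      | succ k =>
        rw [Function.iterate_succ_apply'] at hUm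
        exact hmin k (by lia) (bas_pre_Um hUm)
    have hre : ∀ x ∈ F, 0 < (fBasilica^[n] x).re := by
      intro x hx
      by_contra hcon
      have := hFpre.intermediate_value hx hzF (f := fun w => (fBasilica^[n] w).re)
        (Complex.continuous_re.comp (bas_iter_cont n)).continuousOn
      obtain ⟨w, hw, hw0⟩ := this (show (0 : ℝ) ∈ _ from ⟨not_lt.1 hcon, hzre.le⟩)
      exact hne w hw hw0
    have hU1 : ∀ x ∈ F, fBasilica^[n] x ∈ basU1 := fun x hx =>
      ⟨_, hall x hx, bas_Sq_f (hre x hx)⟩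
    have hKb : Metric.closedBall (1 : ℂ) (2 / 5) ⊆ Metric.ball 1 1 :=
      Metric.closedBall_subset_ball (by norm_num)
    obtain ⟨φ, hφ, hsub⟩ := bas_lift n F hFpre (fun x hx => bas_U1_ball (hU1 x hx))
    have hsub' : F ⊆ φ '' basU1 := by
      intro x hx
      obtain ⟨w, hw, rfl⟩ := hsub hx
      have := hU1 _ hx
      rw [hφ.2 w (hKb hw)] at this
      exact ⟨w, this, rfl⟩
    refine ⟨n, φ, hφ, Set.Subset.antisymm hsub' ?_⟩
    refine bas_sub_comp (x := z) ?_ ?_ (hsub' hzF) hzF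
    · exact bas_U1_conn.image _ (hφ.1.continuousOn.mono (bas_U1_ball.trans hKb))
    · rintro _ ⟨w, hw, rfl⟩
      rw [← bas_mem_iter n, hφ.2 w (hKb (bas_U1_ball hw))]
      exact bas_U1_sub hw

lemma bas_bubble_disj {F G : Set ℂ} (hF : IsBubble F) (hG : IsBubble G) {x : ℂ} (hxF : x ∈ F)
    (hxG : x ∈ G) : F = G := by
  obtain ⟨z, -, rfl⟩ := hF
  obtain ⟨w, -, rfl⟩ := hG
  rw [connectedComponentIn_eq hxF, connectedComponentIn_eq hxG]

/-- If `(F n)` is a sequence of pairwise distinct bubbles of the basilica, then their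
Euclidean diameters tend to `0`. -/
theorem diam_distinct_bubbles_tendsto_zero (F : ℕ → Set ℂ)
    (hbub : ∀ n, IsBubble (F n)) (hdist : Function.Injective F) :
    Tendsto (fun n => Metric.diam (F n)) atTop (𝓝 0) := by
  have key : ∀ ε > 0, {k | ¬ Metric.diam (F k) ≤ 2 * ε}.Finite := by
    intro ε hε
    obtain ⟨δ, hδ, hD⟩ := bas_distortion hε (s := 1 / 10) (by norm_num) (by norm_num)
    by_contra hinf
    -- remove the two periodic bubbles
    have hinf2 : ({k | ¬ Metric.diam (F k) ≤ 2 * ε} \ (F ⁻¹' {basU0, basUm})).Infinite :=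
      Set.Infinite.sdiff hinf ((Set.toFinite {basU0, basUm}).preimage hdist.injOn)
    set S := {k | ¬ Metric.diam (F k) ≤ 2 * ε} \ (F ⁻¹' {basU0, basUm}) with hS
    have hc : ∀ k ∈ S, ∃ c : ℂ, c ∈ Metric.closedBall (0 : ℂ) 2 ∧ Metric.ball c δ ⊆ F k := by
      rintro k ⟨hk1, hk2⟩
      simp only [Set.mem_preimage, Set.mem_insert_iff, Set.mem_singleton_iff, not_or] at hk2
      obtain ⟨n, φ, hφ, hFφ⟩ := bas_bubble (hbub k) hk2.1 hk2.2
      refine ⟨φ 1, ?_, ?_⟩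
      · rw [mem_closedBall_zero_iff]
        exact (bas_branch_bound hφ (Metric.mem_ball_self one_pos)).le
      · rcases hD φ hφ.1 (bas_branch_inj hφ) (bas_branch_deriv hφ)
          (fun z hz => bas_branch_bound hφ hz) with h | h
        · refine absurd ?_ hk1
          have hsub : F k ⊆ Metric.closedBall (φ 1) ε := by
            rw [hFφ]
            exact (Set.image_mono bas_U1_ball).trans h
          exact (Metric.diam_mono hsub Metric.isBounded_closedBall).trans
            (Metric.diam_closedBall hε.le)
        · rw [hFφ]
          exact h.trans (Set.image_mono bas_ball_U1)
    set e := hinf2.natEmbedding with he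
    choose c hcb hcF using fun i => hc (e i) (e i).2
    obtain ⟨p, -, g, hg, hlim⟩ := (isCompact_closedBall (0 : ℂ) 2).tendsto_subseq hcb
    obtain ⟨N, hN⟩ := Metric.cauchySeq_iff'.1 hlim.cauchySeq δ hδ
    have hNN := hN (N + 1) (Nat.le_succ N)
    have hx1 : c (g (N + 1)) ∈ F (e (g N)) := hcF _ hNN
    have hx2 : c (g (N + 1)) ∈ F (e (g (N + 1))) := hcF _ (Metric.mem_ball_self hδ)
    have heq := hdist (bas_bubble_disj (hbub _) (hbub _) hx1 hx2)
    have heq2 := e.injective (Subtype.ext heq)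
    have := hg.injective heq2
    lia
  rw [Metric.tendsto_nhds]
  intro ε hε
  rw [← Nat.cofinite_eq_atTop]
  refine (key (ε / 4) (by positivity)).subset ?_
  intro k hk hle
  apply hk
  rw [Set.mem_ofPred_eq, Real.dist_eq, sub_zero, abs_of_nonneg Metric.diam_nonneg]
  linarith
end
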